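/- arXiv:2404.04352 — 4 statements merged into one kernel-verified Lean document; each statement's English description precedes it below -/
import Mathlib

section
/- Let R be a common row type, τ a type of table names, and O an output type. Suppose Q1 = (L1, p1, π1) and Q2 = (L2, p2, π2) are SPJ queries under bag semantics with output type O. If Q1 and Q2 are equivalent (Q1(D) = Q2(D) as multisets for every database instance D) and there exists an instance D for which Q1(D) is nonempty, then the FROM lists agree as multisets: the multiset of table names underlying L1 equals the multiset of table names underlying L2. -/
/-- The multiset of joined tuples: the multiset product of the tables
`D (L.get i)` for `i : Fin L.length`, with multiplicities multiplied. -/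
def joined {R τ : Type*} (D : τ → Multiset R) :
    (L : List τ) → Multiset (Fin L.length → R)
  | [] => {fun i => i.elim0}
  | T :: L' => (D T).bind (fun r => (joined D L').map (fun t => Fin.cons r t))

/-- The result of the SPJ query `(L, p, π)` under bag semantics on instance `D`:
form the multiset product of the FROM tables, filter by the WHERE predicate `p`,
and map by the SELECT function `π`. -/
def spjResult {R τ O : Type*} (L : List τ) (p : (Fin L.length → R) → Bool)
    (π : (Fin L.length → R) → O) (D : τ → Multiset R) : Multiset O :=
  ((joined D L).filter (fun t => p t = true)).map π

/-- Scaling the multiplicities of each table `T` by `k T` scales the multiset of joined tuples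
by the product of the factors over the FROM list. -/
theorem joined_nsmul {R τ : Type*} (D : τ → Multiset R) (k : τ → ℕ) (L : List τ) :
    joined (fun T => k T • D T) L = (L.map k).prod • joined D L := by
  induction L with
  | nil => simp [joined]
  | cons T L ih =>
    simp only [joined, ih, Multiset.map_nsmul, Multiset.bind, Multiset.join,
      Multiset.sum_nsmul, Multiset.sum_map_nsmul, List.map_cons, List.prod_cons, mul_nsmul']

theorem spjResult_nsmul {R τ O : Type*} (L : List τ) (p : (Fin L.length → R) → Bool)
    (π : (Fin L.length → R) → O) (D : τ → Multiset R) (k : τ → ℕ) :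
    spjResult L p π (fun T => k T • D T) = (L.map k).prod • spjResult L p π D := by
  simp only [spjResult, joined_nsmul, Multiset.filter_nsmul, Multiset.map_nsmul]

/-- A list of names is determined up to permutation by the values of its monomial. -/
theorem List.perm_of_prod_map_eq {τ : Type*} {L1 L2 : List τ}
    (h : ∀ k : τ → ℕ, (L1.map k).prod = (L2.map k).prod) : L1.Perm L2 := by
  classical
  have prod_eq (T : τ) (L : List τ) :
      (L.map (fun S => if S = T then 2 else 1)).prod = 2 ^ L.count T := by
    induction L with
    | nil => simp
    | cons S L ih => by_cases hS : S = T <;> simp [hS, ih, pow_succ, mul_comm]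
  refine List.perm_iff_count.mpr fun T => Nat.pow_right_injective le_rfl ?_
  simpa only [prod_eq] using h fun S => if S = T then 2 else 1

/-- If two SPJ queries are equivalent under bag semantics and one of them returns a
nonempty result on some instance, then their FROM lists agree as multisets of
table names. -/
theorem from_lists_agree_of_equiv {R τ O : Type*}
    (L1 L2 : List τ)
    (p1 : (Fin L1.length → R) → Bool) (π1 : (Fin L1.length → R) → O)
    (p2 : (Fin L2.length → R) → Bool) (π2 : (Fin L2.length → R) → O)
    (hequiv : ∀ D : τ → Multiset R, spjResult L1 p1 π1 D = spjResult L2 p2 π2 D)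
    (hne : ∃ D : τ → Multiset R, spjResult L1 p1 π1 D ≠ 0) :
    (L1 : Multiset τ) = (L2 : Multiset τ) := by
  obtain ⟨D, hD⟩ := hne
  refine Multiset.coe_eq_coe.mpr (List.perm_of_prod_map_eq fun k => ?_)
  have h := congrArg Multiset.card (hequiv fun T => k T • D T)
  rw [spjResult_nsmul, spjResult_nsmul, ← hequiv D, Multiset.card_nsmul,
    Multiset.card_nsmul] at h
  exact Nat.eq_of_mul_eq_mul_right (Multiset.card_pos.mpr hD) h
end

section
/- (Target-bound push-down through conjunction.) Let n ≥ 1, let l⋆ and u⋆ be propositions, and let u i and c i be propositions for each i : Fin n. Suppose that for every i: (l⋆ → c i) and (c i → u i ∧ (u⋆ ∨ ¬ (∀ j, j ≠ i → u j))). Then l⋆ → (∀ i, c i), and (∀ i, c i) → u⋆. In other words, if each conjunct c i lies within the target bound pushed down at an ∧-node — lower bound l⋆ and upper bound u i ∧ (u⋆ ∨ ¬⋀_{j≠i} u j) — then the conjunction ⋀ i c i lies within the node's target bound [l⋆, u⋆]. -/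
/-- (Target-bound push-down through conjunction.) If each conjunct `c i` lies within
the target bound pushed down at an `∧`-node — lower bound `l⋆` and upper bound
`u i ∧ (u⋆ ∨ ¬⋀_{j≠i} u j)` — then the conjunction `⋀ i, c i` lies within the node's
target bound `[l⋆, u⋆]`. -/
theorem and_pushdown_correct (n : ℕ) (hn : 1 ≤ n) (lstar ustar : Prop)
    (u c : Fin n → Prop)
    (h1 : ∀ i, lstar → c i)
    (h2 : ∀ i, c i → u i ∧ (ustar ∨ ¬ (∀ j, j ≠ i → u j))) :
    (lstar → ∀ i, c i) ∧ ((∀ i, c i) → ustar) := by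
  refine ⟨fun hl i => h1 i hl, fun hc => ?_⟩
  exact (h2 ⟨0, hn⟩ (hc _)).2.resolve_right fun hu => hu fun j _ => (h2 j (hc j)).1
end

section
/- (Target-bound push-down through disjunction.) Let n ≥ 1, let l⋆ and u⋆ be propositions, and let l i and c i be propositions for each i : Fin n. Suppose that for every i: (c i → u⋆) and ((l i ∨ (l⋆ ∧ ¬ (∃ j, j ≠ i ∧ l j))) → c i). Then l⋆ → (∃ i, c i), and (∃ i, c i) → u⋆. In other words, if each disjunct c i lies within the target bound pushed down at an ∨-node — lower bound l i ∨ (l⋆ ∧ ¬⋁_{j≠i} l j) and upper bound u⋆ — then the disjunction ⋁ i c i lies within the node's target bound [l⋆, u⋆]. -/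
/-- (Target-bound push-down through disjunction.) If each disjunct `c i` lies within
the target bound pushed down at an `∨`-node — lower bound `l i ∨ (l⋆ ∧ ¬⋁_{j≠i} l j)`
and upper bound `u⋆` — then the disjunction `⋁ i, c i` lies within the node's target
bound `[l⋆, u⋆]`. -/
theorem or_pushdown_correct (n : ℕ) (hn : 1 ≤ n) (lstar ustar : Prop)
    (l c : Fin n → Prop)
    (h1 : ∀ i, c i → ustar)
    (h2 : ∀ i, (l i ∨ (lstar ∧ ¬ (∃ j, j ≠ i ∧ l j))) → c i) :
    (lstar → ∃ i, c i) ∧ ((∃ i, c i) → ustar) := by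
  refine ⟨fun hl => ?_, fun ⟨i, hi⟩ => h1 i hi⟩
  by_cases h : ∃ j, l j
  · obtain ⟨j, hj⟩ := h
    exact ⟨j, h2 j (Or.inl hj)⟩
  · exact ⟨⟨0, hn⟩, h2 _ (Or.inr ⟨hl, fun ⟨j, _, hj⟩ => h ⟨j, hj⟩⟩)⟩
end

section
/- (Weak minimality of the GROUP BY addition set Δ⁺.) Suppose that after removing Δ⁻ the remaining grouping expressions are still strictly coarser than the target on some pair of tuples: there exist t₁, t₂ with P t₁, P t₂, (∀ i ∉ Δ⁻, o i t₁ = o i t₂) and ¬(∀ j, o⋆ j t₁ = o⋆ j t₂). Then no removal alone can achieve the target grouping: there is no S : Set ι such that for all t₁, t₂ with P t₁ and P t₂, (∀ i ∉ S, o i t₁ = o i t₂) ↔ (∀ j, o⋆ j t₁ = o⋆ j t₂). -/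
/-- The removal set `Δ⁻` of GROUP BY repair: the set of working grouping expressions
that can separate two tuples satisfying `P` which agree on all target grouping
expressions. -/
def Dminus {D V ι κ : Type*} (P : D → Prop) (o : ι → D → V) (ostar : κ → D → V) :
    Set ι :=
  { i | ∃ s₁ s₂ : D, P s₁ ∧ P s₂ ∧ (∀ j, ostar j s₁ = ostar j s₂) ∧ o i s₁ ≠ o i s₂ }

/-- (Weak minimality of the GROUP BY addition set `Δ⁺`.) If, after removing `Δ⁻`, the
remaining grouping expressions are still strictly coarser than the target on some pair
of tuples, then no removal alone can achieve the target grouping. -/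
theorem groupby_addition_weakly_minimal {D V ι κ : Type*} (P : D → Prop)
    (o : ι → D → V) (ostar : κ → D → V)
    (h : ∃ t₁ t₂ : D, P t₁ ∧ P t₂ ∧ (∀ i ∉ Dminus P o ostar, o i t₁ = o i t₂) ∧
      ¬(∀ j, ostar j t₁ = ostar j t₂)) :
    ¬ ∃ S : Set ι, ∀ t₁ t₂ : D, P t₁ → P t₂ →
      ((∀ i ∉ S, o i t₁ = o i t₂) ↔ (∀ j, ostar j t₁ = ostar j t₂)) := by
  rintro ⟨S, hS⟩
  obtain ⟨t₁, t₂, h₁, h₂, hagree, hne⟩ := h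
  refine hne ((hS t₁ t₂ h₁ h₂).1 fun i hi => hagree i ?_)
  rintro ⟨s₁, s₂, hs₁, hs₂, hstar, hsep⟩
  exact hsep ((hS s₁ s₂ hs₁ hs₂).2 hstar i hi)
end
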